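/- Let K be a compact C¹ submanifold of ℝⁿ (without boundary) and define, for r > 0, O(r;K) = ⋃_{p∈K} ⋃_{w ∈ UN K_p} B(p + r·w, r), the union of open balls of radius r tangent to K from normal directions. Define R_O(K) = inf{r > 0 : O(r;K) ∩ K ≠ ∅} and let i(K) be the normal injectivity radius, i.e. the supremum of r such that the normal exponential map (p,v) ↦ p + v is injective on {(p,v) : p ∈ K, v ⊥ T_pK, ‖v‖ < r}. Then i(K) = R_O(K). -/

import Mathlib

open scoped RealInnerProductSpace

/-- `K` is a `k`-dimensional embedded `C¹` submanifold (without boundary) of `ℝⁿ`: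
near each of its points, `K` is the image of an injective `C¹` immersion of an open
subset of `ℝᵏ`. -/
def IsC1Submanifold {n : ℕ} (k : ℕ) (K : Set (EuclideanSpace ℝ (Fin n))) : Prop :=
  ∀ p ∈ K, ∃ (U : Set (EuclideanSpace ℝ (Fin k))) (V : Set (EuclideanSpace ℝ (Fin n)))
    (φ : EuclideanSpace ℝ (Fin k) → EuclideanSpace ℝ (Fin n)),
      IsOpen U ∧ IsOpen V ∧ p ∈ V ∧ ContDiffOn ℝ 1 φ U ∧ Set.InjOn φ U ∧
      φ '' U = K ∩ V ∧ ∀ x ∈ U, Function.Injective (fderiv ℝ φ x)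

/-- `K` is a `k`-dimensional embedded `C^{1,1}` submanifold of `ℝⁿ`: a `C¹`
submanifold whose local parametrizations have locally Lipschitz derivative. -/
def IsC11Submanifold {n : ℕ} (k : ℕ) (K : Set (EuclideanSpace ℝ (Fin n))) : Prop :=
  ∀ p ∈ K, ∃ (U : Set (EuclideanSpace ℝ (Fin k))) (V : Set (EuclideanSpace ℝ (Fin n)))
    (φ : EuclideanSpace ℝ (Fin k) → EuclideanSpace ℝ (Fin n)) (L : NNReal),
      IsOpen U ∧ IsOpen V ∧ p ∈ V ∧ ContDiffOn ℝ 1 φ U ∧ Set.InjOn φ U ∧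
      φ '' U = K ∩ V ∧ (∀ x ∈ U, Function.Injective (fderiv ℝ φ x)) ∧
      LipschitzOnWith L (fderiv ℝ φ) U

/-- `w` is a normal vector to `K` at `p`: it is orthogonal to the tangent cone of
`K` at `p`. -/
def IsNormalAt {n : ℕ} (K : Set (EuclideanSpace ℝ (Fin n))) (p w : EuclideanSpace ℝ (Fin n)) :
    Prop :=
  ∀ u ∈ tangentConeAt ℝ K p, ⟪u, w⟫ = 0

/-- The normal injectivity radius `i(K, ℝⁿ)` of `K ⊂ ℝⁿ`: the supremum of `0` and
all `r > 0` such that the normal exponential map `(p, v) ↦ p + v` is injective on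
normal vectors of length `< r`. -/
noncomputable def normalInjRad {n : ℕ} (K : Set (EuclideanSpace ℝ (Fin n))) : ℝ :=
  sSup ({0} ∪ {r : ℝ | 0 < r ∧
    Set.InjOn (fun pv : EuclideanSpace ℝ (Fin n) × EuclideanSpace ℝ (Fin n) => pv.1 + pv.2)
      {pv | pv.1 ∈ K ∧ IsNormalAt K pv.1 pv.2 ∧ ‖pv.2‖ < r}})

/-- The rolling-ball radius `R_O(K, ℝⁿ)`: the infimum of radii `r > 0` such that some
open ball of radius `r` tangent to `K` from a normal direction meets `K`. -/
noncomputable def ballRad {n : ℕ} (K : Set (EuclideanSpace ℝ (Fin n))) : ℝ :=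
  sInf {r : ℝ | 0 < r ∧ ∃ p ∈ K, ∃ w : EuclideanSpace ℝ (Fin n),
    IsNormalAt K p w ∧ ‖w‖ = 1 ∧ ∃ q ∈ K, dist (p + r • w) q < r}

section

open Filter Topology Set Module

/-- Euclidean space of dimension `n`. -/
abbrev Euc (n : ℕ) := EuclideanSpace ℝ (Fin n)

/-- `S` is spanned by velocities of curves in `K` through `p`, and its orthogonal complement
consists of normal vectors. -/
def HasTangentSpace {n : ℕ} (K : Set (Euc n)) (p : Euc n) (S : Submodule ℝ (Euc n)) : Prop :=
  (∀ w ∈ Sᗮ, IsNormalAt K p w) ∧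
    ∀ b ∈ S, ∃ γ : ℝ → Euc n, γ 0 = p ∧ HasDerivAt γ b 0 ∧ ∀ᶠ t in 𝓝 (0 : ℝ), γ t ∈ K

/-- `K` has at `p` a tangent space of dimension at most `k`. -/
def IsRegularPoint {n : ℕ} (k : ℕ) (K : Set (Euc n)) (p : Euc n) : Prop :=
  ∃ S : Submodule ℝ (Euc n), finrank ℝ S ≤ k ∧ HasTangentSpace K p S

/-- Normal vectors of length `< r` at different points of `K` have different end points. -/
def NormalInjective {n : ℕ} (K : Set (Euc n)) (r : ℝ) : Prop :=
  ∀ p ∈ K, ∀ q ∈ K, ∀ v w, IsNormalAt K p v → IsNormalAt K q w → ‖v‖ < r → ‖w‖ < r →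
    p + v = q + w → p = q

variable {n k : ℕ} {K : Set (Euc n)} {p : Euc n} {S : Submodule ℝ (Euc n)} {r : ℝ}

lemma isNormalAt_zero (K : Set (Euc n)) (p : Euc n) : IsNormalAt K p 0 := by
  intro u _; simp

lemma IsNormalAt.smul {w : Euc n} (h : IsNormalAt K p w) (c : ℝ) : IsNormalAt K p (c • w) := by
  intro u hu
  rw [inner_smul_right, h u hu, mul_zero]

lemma HasTangentSpace.fderiv_eq_zero (h : HasTangentSpace K p S) {f : Euc n → ℝ}
    {f' : Euc n →L[ℝ] ℝ} (hf : HasFDerivAt f f' p) (hmax : IsLocalMaxOn f K p)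
    {b : Euc n} (hb : b ∈ S) : f' b = 0 := by
  obtain ⟨γ, rfl, hd, hK⟩ := h.2 b hb
  have ht : Tendsto γ (𝓝 0) (𝓝[K] (γ 0)) :=
    tendsto_nhdsWithin_iff.2 ⟨hd.continuousAt, hK⟩
  have hm : IsLocalMax (f ∘ γ) 0 := ht.eventually hmax
  exact hm.hasDerivAt_eq_zero (hf.comp_hasDerivAt 0 hd)

lemma HasTangentSpace.isNormalAt_sub (h : HasTangentSpace K p S) {x : Euc n}
    (hmin : IsLocalMinOn (fun z => ‖z - x‖) K p) : IsNormalAt K p (x - p) := by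
  apply h.1
  rw [Submodule.mem_orthogonal]
  intro b hb
  have hd : HasFDerivAt (fun z : Euc n => -‖z - x‖ ^ 2)
      (-(2 • (innerSL ℝ (p - x)).comp (ContinuousLinearMap.id ℝ (Euc n)))) p :=
    (((hasFDerivAt_id p).sub_const x).norm_sq).neg
  have hm : IsLocalMaxOn (fun z : Euc n => -‖z - x‖ ^ 2) K p := by
    filter_upwards [hmin] with z hz
    have := norm_nonneg (p - x)
    simp only [neg_le_neg_iff]
    gcongr
  have := h.fderiv_eq_zero hd hm hb
  simp at this
  rw [real_inner_comm, ← neg_sub, inner_neg_left, inner_sub_left, this, neg_zero]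

lemma exists_nearest (hK : IsCompact K) (hne : K.Nonempty) (x : Euc n) :
    ∃ p ∈ K, ∀ z ∈ K, ‖p - x‖ ≤ ‖z - x‖ := by
  obtain ⟨p, hp, h⟩ := hK.exists_isMinOn hne (f := fun z => ‖z - x‖) (by fun_prop)
  exact ⟨p, hp, fun z hz => h hz⟩

lemma isNormalAt_of_nearest (hreg : IsRegularPoint k K p) {x : Euc n}
    (h : ∀ z ∈ K, ‖p - x‖ ≤ ‖z - x‖) : IsNormalAt K p (x - p) := by
  obtain ⟨S, -, hS⟩ := hreg
  exact hS.isNormalAt_sub (IsMinOn.localize fun z hz => h z hz)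

/-- Near a point of a set with normal injectivity radius at least `r`, the set stays outside the
tangent balls of radius `r / 2`. -/
lemma NormalInjective.inner_le_of_norm_eq_one (hinj : NormalInjective K r) (hK : IsCompact K)
    {g : Euc n} (hg : g ∈ K) (hS : HasTangentSpace K g S) {ρ : ℝ} (hρr : ρ ≤ r / 4)
    (hreg : ∀ x ∈ K, ‖x - g‖ < ρ → IsRegularPoint k K x) {y : Euc n} (hy : y ∈ K)
    (hyg : ‖y - g‖ < ρ) {w : Euc n} (hw : w ∈ Sᗮ) (hw1 : ‖w‖ = 1) :
    ⟪w, y - g⟫ ≤ ‖y - g‖ ^ 2 / r := by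
  by_contra! hlt
  have hρ0 : 0 < ρ := (norm_nonneg _).trans_lt hyg
  have hr : 0 < r := by linarith
  have hyg0 : 0 < ‖y - g‖ := by
    rw [norm_pos_iff]
    intro h0
    simp [h0] at hlt
  set τ₀ := ‖y - g‖ ^ 2 with hτ₀
  have hτ₀p : 0 < τ₀ := by positivity
  set m := ⟪w, y - g⟫ - τ₀ / r with hm
  have hmp : 0 < m := by rw [hm]; linarith
  obtain ⟨ρ₁, h1, h2⟩ := exists_between hyg
  have hρ₁ : 0 < ρ₁ := hyg0.trans h1
  have hone : 1 < ρ₁ ^ 2 / τ₀ := by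
    rw [one_lt_div hτ₀p, hτ₀]
    gcongr
  obtain ⟨N, hN⟩ := ((tendsto_pow_atTop_atTop_of_one_lt hone).eventually_gt_atTop
    (ρ₁ / (m / 2))).exists
  rw [div_lt_iff₀ (by positivity)] at hN
  set f : Euc n → ℝ := fun z => ⟪w, z - g⟫ - ‖z - g‖ ^ 2 / r - m / 2 * (‖z - g‖ ^ 2 / τ₀) ^ N
    with hf
  obtain ⟨z, ⟨hzK, hzb⟩, hz⟩ := (hK.inter_right (Metric.isClosed_closedBall
    (x := g) (ε := ρ₁))).exists_isMaxOn (f := f)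
    ⟨y, hy, by rw [Metric.mem_closedBall, dist_eq_norm]; exact h1.le⟩ (by fun_prop)
  have hfy : f y = m / 2 := by
    simp only [hf]
    rw [← hτ₀, div_self hτ₀p.ne', one_pow]
    rw [hm]; ring
  have hfz : 0 < f z := by
    have : f y ≤ f z := hz ⟨hy, by rw [Metric.mem_closedBall, dist_eq_norm]; exact h1.le⟩
    linarith
  rw [Metric.mem_closedBall, dist_eq_norm] at hzb
  have hcs : ⟪w, z - g⟫ ≤ ‖z - g‖ := by
    simpa [hw1] using real_inner_le_norm w (z - g)
  have hzlt : ‖z - g‖ < ρ₁ := by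
    refine lt_of_le_of_ne hzb fun h => ?_
    simp only [hf, h] at hfz
    have : 0 ≤ ρ₁ ^ 2 / r := by positivity
    nlinarith
  have hz0 : z ≠ g := by
    rintro rfl
    simp only [hf] at hfz
    have : 0 ≤ m / 2 * (‖z - z‖ ^ 2 / τ₀) ^ N := by positivity
    simp at hfz this
    linarith
  have hloc : IsLocalMaxOn f K z := by
    have : ∀ᶠ x in 𝓝[K] z, x ∈ K ∩ Metric.closedBall g ρ₁ := by
      have h3 : ∀ᶠ x in 𝓝 z, x ∈ Metric.closedBall g ρ₁ :=
        Filter.mem_of_superset (Metric.isOpen_ball.mem_nhds (by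
          rw [Metric.mem_ball, dist_eq_norm]; exact hzlt)) Metric.ball_subset_closedBall
      exact (eventually_mem_nhdsWithin).and (h3.filter_mono nhdsWithin_le_nhds)
    filter_upwards [this] with x hx using hz hx
  obtain ⟨S', -, hS'⟩ := hreg z hzK (hzlt.trans h2)
  set lam : ℝ := 2 / r + m / 2 * (N * (‖z - g‖ ^ 2 / τ₀) ^ (N - 1)) * (2 / τ₀) with hlam
  have hlam2 : 2 / r ≤ lam := by
    rw [hlam]
    have : 0 ≤ m / 2 * (N * (‖z - g‖ ^ 2 / τ₀) ^ (N - 1)) * (2 / τ₀) := by positivity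
    linarith
  have hlam0 : 0 < lam := lt_of_lt_of_le (by positivity) hlam2
  have hsub : HasFDerivAt (fun x : Euc n => x - g) (ContinuousLinearMap.id ℝ (Euc n)) z :=
    (hasFDerivAt_id z).sub_const g
  have hsq := hsub.norm_sq
  have hd := (((innerSL ℝ w).hasFDerivAt.comp z hsub).sub (hsq.mul_const r⁻¹)).sub
    (((hsq.mul_const τ₀⁻¹).pow N).const_mul (m / 2))
  have hnorm : lam⁻¹ • w - (z - g) ∈ S'ᗮ := by
    rw [Submodule.mem_orthogonal]
    intro b hb
    have h0 := hS'.fderiv_eq_zero (f := f) hd hloc hb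
    simp only [sub_apply, ContinuousLinearMap.comp_apply,
      smul_apply, ContinuousLinearMap.id_apply, innerSL_apply_apply,
      smul_eq_mul, nsmul_eq_mul, Nat.cast_ofNat] at h0
    have h4 : ⟪w, b⟫ = lam * ⟪z - g, b⟫ := by
      rw [hlam]
      simp only [div_eq_mul_inv] at h0 ⊢
      linear_combination h0
    rw [inner_sub_right, inner_smul_right, real_inner_comm, h4, real_inner_comm (z - g) b]
    field_simp
    ring
  have hwl : ‖lam⁻¹ • w‖ ≤ r / 2 := by
    rw [norm_smul, hw1, mul_one, Real.norm_of_nonneg (by positivity)]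
    calc lam⁻¹ ≤ (2 / r)⁻¹ := by gcongr
      _ = r / 2 := by rw [inv_div]
  refine hz0 (hinj z hzK g hg _ _ (hS'.1 _ hnorm) ((hS.1 w hw).smul lam⁻¹) ?_ ?_ ?_)
  · calc _ ≤ ‖lam⁻¹ • w‖ + ‖z - g‖ := norm_sub_le _ _
      _ < r := by linarith
  · linarith
  · abel

lemma NormalInjective.inner_le (hinj : NormalInjective K r) (hK : IsCompact K)
    {g : Euc n} (hg : g ∈ K) (hS : HasTangentSpace K g S) {ρ : ℝ} (hρr : ρ ≤ r / 4)
    (hreg : ∀ x ∈ K, ‖x - g‖ < ρ → IsRegularPoint k K x) {y : Euc n} (hy : y ∈ K)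
    (hyg : ‖y - g‖ < ρ) {w : Euc n} (hw : w ∈ Sᗮ) :
    ⟪w, y - g⟫ ≤ ‖w‖ * ‖y - g‖ ^ 2 / r := by
  rcases eq_or_ne w 0 with rfl | hw0
  · simp
  have hn : ‖w‖ ≠ 0 := norm_ne_zero_iff.2 hw0
  have h := hinj.inner_le_of_norm_eq_one hK hg hS hρr hreg hy hyg
    (Sᗮ.smul_mem ‖w‖⁻¹ hw) (norm_smul_inv_norm hw0)
  rw [inner_smul_left] at h
  simp only [map_inv₀, conj_trivial] at h
  rw [inv_mul_le_iff₀ (by positivity)] at h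
  linarith [mul_div_assoc ‖w‖ (‖y - g‖ ^ 2) r]

/-- The tangential part of `e - g` is not small if all points of `K` near `g` are regular. -/
lemma NormalInjective.le_norm_starProjection (hinj : NormalInjective K r) (hK : IsCompact K)
    {g : Euc n} (hg : g ∈ K) (hS : HasTangentSpace K g S) {ρ : ℝ} (hρ0 : 0 < ρ) (hρr : ρ ≤ r / 4)
    (hreg : ∀ x ∈ K, ‖x - g‖ < ρ → IsRegularPoint k K x) {e : Euc n} (he : e ∈ K)
    (hρe : ρ ≤ ‖e - g‖) (her : ‖e - g‖ ≤ r / 100) :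
    ρ / 5 ≤ ‖S.starProjection (e - g)‖ := by
  by_contra! hlt
  have hr : 0 < r := by linarith
  obtain ⟨z, ⟨hzK, hzb⟩, hz⟩ := (hK.inter_right (Metric.isClosed_closedBall
    (x := g) (ε := ρ / 2))).exists_isMinOn (f := fun z => ‖z - e‖)
    ⟨g, hg, Metric.mem_closedBall_self (by positivity)⟩ (by fun_prop)
  rw [Metric.mem_closedBall, dist_eq_norm] at hzb
  have hmin : ‖z - e‖ ≤ ‖g - e‖ := hz ⟨hg, Metric.mem_closedBall_self (by positivity)⟩
  have hzlt : ‖z - g‖ < ρ / 2 := by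
    refine lt_of_le_of_ne hzb fun h => ?_
    set t := S.starProjection (e - g) with ht
    have hn : e - g - t ∈ Sᗮ := Submodule.sub_starProjection_mem_orthogonal _
    have h1 := hinj.inner_le hK hg hS hρr hreg hzK (by rw [h]; linarith) hn
    have hnn : ‖e - g - t‖ ≤ ‖e - g‖ := by
      have := Submodule.norm_starProjection_apply_le Sᗮ (e - g)
      rwa [Submodule.starProjection_orthogonal_val] at this
    have h2 : ⟪t, z - g⟫ ≤ ρ / 5 * (ρ / 2) := by
      calc _ ≤ ‖t‖ * ‖z - g‖ := real_inner_le_norm _ _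
        _ ≤ _ := by rw [h]; gcongr
    have h3 : ‖e - g - t‖ * ‖z - g‖ ^ 2 / r ≤ ρ ^ 2 / 400 := by
      rw [h, div_le_iff₀ hr]
      have : ‖e - g - t‖ ≤ r / 100 := hnn.trans her
      nlinarith [sq_nonneg ρ]
    have h4 : ‖z - e‖ ^ 2 = ‖z - g‖ ^ 2 - 2 * ⟪e - g, z - g⟫ + ‖g - e‖ ^ 2 := by
      have : z - e = (z - g) - (e - g) := by abel
      rw [this, norm_sub_sq_real, real_inner_comm, norm_sub_rev e g]
    have h5 : ⟪e - g, z - g⟫ = ⟪t, z - g⟫ + ⟪e - g - t, z - g⟫ := by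
      rw [← inner_add_left]; congr 1; abel
    have h6 : ‖z - e‖ ^ 2 ≤ ‖g - e‖ ^ 2 := by gcongr
    rw [h] at h4
    have : 0 < ρ ^ 2 := by positivity
    nlinarith
  have hloc : IsLocalMinOn (fun z => ‖z - e‖) K z := by
    have : ∀ᶠ x in 𝓝[K] z, x ∈ K ∩ Metric.closedBall g (ρ / 2) := by
      have h3 : ∀ᶠ x in 𝓝 z, x ∈ Metric.closedBall g (ρ / 2) :=
        Filter.mem_of_superset (Metric.isOpen_ball.mem_nhds (by
          rw [Metric.mem_ball, dist_eq_norm]; exact hzlt)) Metric.ball_subset_closedBall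
      exact (eventually_mem_nhdsWithin).and (h3.filter_mono nhdsWithin_le_nhds)
    filter_upwards [this] with x hx using hz hx
  obtain ⟨S', -, hS'⟩ := hreg z hzK (by linarith)
  have hze : z = e := by
    refine hinj z hzK e he (e - z) 0 (hS'.isNormalAt_sub hloc) (isNormalAt_zero _ _) ?_ ?_
      (by abel)
    · rw [norm_sub_rev]
      rw [norm_sub_rev g e] at hmin
      linarith
    · simpa using hr
  rw [hze] at hzlt
  linarith

/-- An embedded `C¹` disc `D = φ (closedBall 0 δ₀)` in `K` whose derivative is close to the
isometry `J` with adjoint `A`, such that all points of `K` near its centre and outside the disc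
are regular. -/
structure IsFlatDisc {n k : ℕ} (K : Set (Euc n)) (φ : Euc k → Euc n) (J : Euc k →L[ℝ] Euc n)
    (A : Euc n →L[ℝ] Euc k) (φ' : Euc k → Euc k →L[ℝ] Euc n) (δ₀ R₀ : ℝ) : Prop where
  inner_left : ∀ v x, ⟪J v, x⟫ = ⟪v, A x⟫
  left_inv : ∀ v, A (J v) = v
  radius_pos : 0 < δ₀
  regular_pos : 0 < R₀
  subset : φ '' Metric.closedBall 0 δ₀ ⊆ K
  hasFDerivAt : ∀ α, ‖α‖ ≤ δ₀ → HasFDerivAt φ (φ' α) α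
  norm_deriv_sub_le : ∀ α, ‖α‖ ≤ δ₀ → ‖φ' α - J‖ ≤ 1 / 100
  norm_deriv_sub_small : ∀ ε > 0, ∃ δ > 0, ∀ α, ‖α‖ ≤ δ → ‖φ' α - J‖ ≤ ε
  regular : ∀ x ∈ K, ‖x - φ 0‖ < R₀ → x ∉ φ '' Metric.closedBall 0 δ₀ → IsRegularPoint k K x

lemma isNormalAt_of_eventually {w : Euc n}
    (h : ∀ ε > 0, ∀ᶠ x in 𝓝[K] p, |⟪x - p, w⟫| ≤ ε * ‖x - p‖) : IsNormalAt K p w := by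
  intro u hu
  obtain ⟨c, d, hd, hdK, hcd⟩ := mem_tangentConeAt_iff_exists_seq.1 hu
  have hdp : Tendsto (fun m => p + d m) atTop (𝓝[K] p) := by
    refine tendsto_nhdsWithin_iff.2 ⟨?_, hdK⟩
    simpa using hd.const_add p
  have hbound : ∀ ε > 0, |⟪u, w⟫| ≤ ε * ‖u‖ := by
    intro ε hε
    have h1 : Tendsto (fun m => |⟪c m • d m, w⟫|) atTop (𝓝 |⟪u, w⟫|) :=
      (hcd.inner tendsto_const_nhds).abs
    have h2 : Tendsto (fun m => ε * ‖c m • d m‖) atTop (𝓝 (ε * ‖u‖)) :=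
      hcd.norm.const_mul ε
    refine le_of_tendsto_of_tendsto h1 h2 ?_
    filter_upwards [hdp.eventually (h ε hε)] with m hm
    rw [add_sub_cancel_left] at hm
    rw [inner_smul_left, norm_smul, abs_mul]
    simp only [conj_trivial, Real.norm_eq_abs]
    nlinarith [mul_le_mul_of_nonneg_left hm (abs_nonneg (c m))]
  by_contra h0
  have hpos : 0 < |⟪u, w⟫| := abs_pos.2 h0
  have := hbound (|⟪u, w⟫| / (2 * (‖u‖ + 1))) (by positivity)
  rw [div_mul_eq_mul_div, le_div_iff₀ (by positivity)] at this
  nlinarith [norm_nonneg u]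

namespace IsFlatDisc

variable {φ : Euc k → Euc n} {J : Euc k →L[ℝ] Euc n} {A : Euc n →L[ℝ] Euc k}
  {φ' : Euc k → Euc k →L[ℝ] Euc n} {δ₀ R₀ : ℝ}

lemma norm_map (h : IsFlatDisc K φ J A φ' δ₀ R₀) (v : Euc k) : ‖J v‖ = ‖v‖ := by
  have : ‖J v‖ ^ 2 = ‖v‖ ^ 2 := by
    rw [← real_inner_self_eq_norm_sq, ← real_inner_self_eq_norm_sq, h.inner_left, h.left_inv]
  exact (pow_left_inj₀ (norm_nonneg _) (norm_nonneg _) two_ne_zero).1 this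

lemma norm_adjoint_le (h : IsFlatDisc K φ J A φ' δ₀ R₀) (x : Euc n) : ‖A x‖ ≤ ‖x‖ := by
  have h1 : ‖A x‖ * ‖A x‖ ≤ ‖A x‖ * ‖x‖ := by
    rw [← real_inner_self_eq_norm_mul_norm, ← h.inner_left, ← h.norm_map (A x)]
    exact real_inner_le_norm _ _
  rcases (norm_nonneg (A x)).eq_or_lt with h0 | h0
  · rw [← h0]; exact norm_nonneg x
  · exact le_of_mul_le_mul_left h1 h0

lemma map_mem (h : IsFlatDisc K φ J A φ' δ₀ R₀) {α : Euc k} (hα : ‖α‖ ≤ δ₀) : φ α ∈ K :=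
  h.subset ⟨α, by simpa using hα, rfl⟩

lemma norm_sub_sub_le (h : IsFlatDisc K φ J A φ' δ₀ R₀) {ε δ : ℝ} (hδ : δ ≤ δ₀)
    (hε : ∀ α, ‖α‖ ≤ δ → ‖φ' α - J‖ ≤ ε) {α β : Euc k} (hα : ‖α‖ ≤ δ) (hβ : ‖β‖ ≤ δ) :
    ‖φ β - φ α - J (β - α)‖ ≤ ε * ‖β - α‖ :=
  (convex_closedBall (0 : Euc k) δ).norm_image_sub_le_of_norm_hasFDerivWithin_le'
    (fun x hx => (h.hasFDerivAt x (by
      rw [mem_closedBall_zero_iff] at hx; linarith)).hasFDerivWithinAt)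
    (fun x hx => hε x (by simpa using hx)) (by simpa using hα) (by simpa using hβ)

lemma norm_sub_sub_le' (h : IsFlatDisc K φ J A φ' δ₀ R₀) {α β : Euc k} (hα : ‖α‖ ≤ δ₀)
    (hβ : ‖β‖ ≤ δ₀) : ‖φ β - φ α - J (β - α)‖ ≤ 1 / 100 * ‖β - α‖ :=
  h.norm_sub_sub_le le_rfl h.norm_deriv_sub_le hα hβ

lemma norm_map_sub_le (h : IsFlatDisc K φ J A φ' δ₀ R₀) {α β : Euc k} (hα : ‖α‖ ≤ δ₀)
    (hβ : ‖β‖ ≤ δ₀) : ‖φ β - φ α‖ ≤ 101 / 100 * ‖β - α‖ := by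
  have h1 := h.norm_sub_sub_le' hα hβ
  have h2 := norm_le_norm_sub_add (φ β - φ α) (J (β - α))
  rw [h.norm_map] at h2
  linarith

lemma le_norm_map_sub (h : IsFlatDisc K φ J A φ' δ₀ R₀) {α β : Euc k} (hα : ‖α‖ ≤ δ₀)
    (hβ : ‖β‖ ≤ δ₀) : 99 / 100 * ‖β - α‖ ≤ ‖φ β - φ α‖ := by
  have h1 := h.norm_sub_sub_le' hα hβ
  have h2 := norm_le_norm_sub_add (J (β - α)) (φ β - φ α)
  rw [h.norm_map, norm_sub_rev (J _)] at h2
  linarith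

/-- A point in nearly normal direction from the disc is far from the disc. -/
lemma le_norm_sub_map (h : IsFlatDisc K φ J A φ' δ₀ R₀) {α β : Euc k} (hα : ‖α‖ ≤ δ₀)
    (hβ : ‖β‖ ≤ δ₀) {y : Euc n} (hy : ‖A (y - φ α)‖ ≤ ‖y - φ α‖ / 20) :
    3 / 4 * ‖y - φ α‖ ≤ ‖y - φ β‖ := by
  set X := y - φ α
  set b := β - α
  have h1 := h.norm_sub_sub_le' hα hβ
  have h2 : ‖X - J b‖ ≤ ‖y - φ β‖ + 1 / 100 * ‖b‖ := by
    have : X - J b = (y - φ β) + (φ β - φ α - J b) := by simp only [X]; abel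
    rw [this]
    exact (norm_add_le _ _).trans (by gcongr)
  have h3 : ‖X - J b‖ ^ 2 = ‖X‖ ^ 2 - 2 * ⟪b, A X⟫ + ‖b‖ ^ 2 := by
    rw [norm_sub_sq_real, real_inner_comm, h.inner_left, h.norm_map]
  have h4 : ⟪b, A X⟫ ≤ ‖b‖ * (‖X‖ / 20) :=
    (real_inner_le_norm _ _).trans (by gcongr)
  have h5 : (3 / 4 * ‖X‖ + 1 / 100 * ‖b‖) ^ 2 ≤ ‖X - J b‖ ^ 2 := by
    rw [h3]
    nlinarith [sq_nonneg (‖X‖ - ‖b‖), sq_nonneg ‖X‖, sq_nonneg ‖b‖]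
  have h6 := (pow_le_pow_iff_left₀ (by positivity) (norm_nonneg _) two_ne_zero).1 h5
  linarith

/-- At points of the disc that are not accumulated by the rest of `K`, the set `K` has a tangent
space. -/
lemma hasTangentSpace (h : IsFlatDisc K φ J A φ' δ₀ R₀) {α : Euc k} (hα : ‖α‖ < δ₀)
    (hfree : φ α ∉ closure (K \ φ '' Metric.closedBall 0 δ₀)) :
    HasTangentSpace K (φ α) (φ' α).range := by
  have hder := h.hasFDerivAt α hα.le
  refine ⟨fun w hw => isNormalAt_of_eventually fun ε hε => ?_, ?_⟩
  · have h1 := hder.isLittleO.def (c := ε / (2 * (‖w‖ + 1))) (by positivity)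
    obtain ⟨δ, hδ, h2⟩ := Metric.eventually_nhds_iff.1 h1
    have h3 : ∀ᶠ x in 𝓝 (φ α), x ∈ (closure (K \ φ '' Metric.closedBall 0 δ₀))ᶜ :=
      isClosed_closure.isOpen_compl.mem_nhds hfree
    have h4 : ∀ᶠ x in 𝓝 (φ α), dist x (φ α) < δ / 2 := Metric.ball_mem_nhds _ (by positivity)
    filter_upwards [eventually_mem_nhdsWithin, h3.filter_mono nhdsWithin_le_nhds,
      h4.filter_mono nhdsWithin_le_nhds] with x hxK hx hxδ
    have hxD : x ∈ φ '' Metric.closedBall 0 δ₀ := by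
      by_contra hxD
      exact hx (subset_closure ⟨hxK, hxD⟩)
    obtain ⟨β, hβ, rfl⟩ := hxD
    rw [mem_closedBall_zero_iff] at hβ
    rw [dist_eq_norm] at hxδ
    have h5 := h.le_norm_map_sub hα.le hβ
    have h6 := h2 (y := β) (by rw [dist_eq_norm]; linarith [norm_nonneg (β - α)])
    have h7 : ⟪φ' α (β - α), w⟫ = 0 := (Submodule.mem_orthogonal _ _).1 hw _ ⟨_, rfl⟩
    have h8 : ⟪φ β - φ α, w⟫ = ⟪φ β - φ α - φ' α (β - α), w⟫ := by
      rw [inner_sub_left _ (φ' α (β - α)), h7, sub_zero]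
    rw [h8]
    refine (abs_real_inner_le_norm _ _).trans ?_
    calc _ ≤ ε / (2 * (‖w‖ + 1)) * ‖β - α‖ * ‖w‖ := by gcongr
      _ = ε * (‖β - α‖ / 2) * (‖w‖ / (‖w‖ + 1)) := by field_simp
      _ ≤ ε * ‖φ β - φ α‖ * 1 := by
        gcongr
        · linarith [norm_nonneg (β - α)]
        · rw [div_le_one (by positivity)]; linarith
      _ = _ := mul_one _
  · rintro _ ⟨v, rfl⟩
    have hline : HasDerivAt (fun t : ℝ => α + t • v) v 0 := by
      simpa using ((hasDerivAt_id (0 : ℝ)).smul_const v).const_add α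
    refine ⟨fun t => φ (α + t • v), by simp, ?_, ?_⟩
    · refine HasFDerivAt.comp_hasDerivAt (l := φ) (0 : ℝ) ?_ hline
      simpa using hder
    · have : ∀ᶠ t : ℝ in 𝓝 0, α + t • v ∈ Metric.ball (0 : Euc k) δ₀ :=
        hline.continuousAt.eventually (Metric.isOpen_ball.mem_nhds (by simpa using hα))
      filter_upwards [this] with t ht
      exact h.map_mem (by rw [mem_ball_zero_iff] at ht; exact ht.le)

lemma isRegularPoint (h : IsFlatDisc K φ J A φ' δ₀ R₀) {α : Euc k} (hα : ‖α‖ < δ₀)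
    (hfree : φ α ∉ closure (K \ φ '' Metric.closedBall 0 δ₀)) :
    IsRegularPoint k K (φ α) := by
  refine ⟨_, ?_, h.hasTangentSpace hα hfree⟩
  have := LinearMap.finrank_range_le (φ' α : Euc k →ₗ[ℝ] Euc n)
  simpa using this

lemma isCompact_image (h : IsFlatDisc K φ J A φ' δ₀ R₀) :
    IsCompact (φ '' Metric.closedBall 0 δ₀) :=
  (isCompact_closedBall 0 δ₀).image_of_continuousOn fun α hα =>
    (h.hasFDerivAt α (by simpa using hα)).continuousAt.continuousWithinAt

/-- The difference from a nearest point in the disc is almost normal to the disc. -/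
lemma norm_adjoint_sub_le (h : IsFlatDisc K φ J A φ' δ₀ R₀) {α : Euc k} (hα : ‖α‖ < δ₀) {ε : ℝ}
    (hε : ‖φ' α - J‖ ≤ ε) {x : Euc n} (hx : ∀ z ∈ φ '' Metric.closedBall 0 δ₀,
      ‖φ α - x‖ ≤ ‖z - x‖) : ‖A (x - φ α)‖ ≤ ε * ‖x - φ α‖ := by
  have hd : HasFDerivAt (fun β => ‖φ β - x‖ ^ 2)
      (2 • (innerSL ℝ (φ α - x)).comp (φ' α)) α :=
    ((h.hasFDerivAt α hα.le).sub_const x).norm_sq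
  have hmin : IsLocalMin (fun β => ‖φ β - x‖ ^ 2) α := by
    have : ∀ᶠ β in 𝓝 α, β ∈ Metric.ball (0 : Euc k) δ₀ :=
      Metric.isOpen_ball.mem_nhds (by simpa using hα)
    filter_upwards [this] with β hβ
    have := hx (φ β) ⟨β, Metric.ball_subset_closedBall hβ, rfl⟩
    gcongr
  have h0 : ∀ v, ⟪x - φ α, φ' α v⟫ = 0 := by
    intro v
    have := congrArg (fun L : Euc k →L[ℝ] ℝ => L v) (hmin.hasFDerivAt_eq_zero hd)
    simp at this
    rw [← neg_sub, inner_neg_left, inner_sub_left, this, neg_zero]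
  set X := x - φ α
  have h1 : ‖A X‖ * ‖A X‖ ≤ ‖A X‖ * (ε * ‖X‖) := by
    rw [← real_inner_self_eq_norm_mul_norm, ← h.inner_left]
    have : ⟪J (A X), X⟫ = ⟪(J - φ' α) (A X), X⟫ := by
      rw [sub_apply, inner_sub_left, real_inner_comm _ (φ' α _), h0, sub_zero]
    rw [this]
    calc _ ≤ ‖(J - φ' α) (A X)‖ * ‖X‖ := real_inner_le_norm _ _
      _ ≤ (ε * ‖A X‖) * ‖X‖ := by
        gcongr
        refine ((J - φ' α).le_opNorm _).trans ?_
        rw [norm_sub_rev]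
        gcongr
      _ = _ := by ring
  rcases (norm_nonneg (A X)).eq_or_lt with h2 | h2
  · rw [← h2]
    have := (norm_nonneg _).trans hε
    positivity
  · exact le_of_mul_le_mul_left h1 h2

/-- A point of `K` lying in nearly normal direction from the disc cannot locally maximize the
distance from the disc, corrected by a tangential term. -/
lemma not_isLocalMaxOn (h : IsFlatDisc K φ J A φ' δ₀ R₀) (hinj : NormalInjective K r)
    (hK : IsCompact K) {c δ : ℝ} (hc0 : 0 < c) (hc : c ≤ 1 / 20) (hδ : δ ≤ δ₀)
    (hε : ∀ α, ‖α‖ ≤ δ → ‖φ' α - J‖ ≤ c / 100) {α : Euc k} {x : Euc n} (hx : x ∈ K)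
    (hx0 : x ≠ φ α) (hAx : ‖A (x - φ α)‖ ≤ c * ‖x - φ α‖)
    (hαδ : ‖α‖ + ‖x - φ α‖ / c ≤ δ)
    (hr : 2 * (‖x - φ α‖ / c) + ‖x - φ α‖ ≤ r / 100)
    (hR : ‖x - φ 0‖ + ‖x - φ α‖ ≤ R₀) :
    ¬ IsLocalMaxOn (fun z => ‖z - φ α‖ ^ 2 - (c ^ 2)⁻¹ * ‖A (z - φ α)‖ ^ 2) K x := by
  intro hloc
  set X := x - φ α with hX
  have hXpos : 0 < ‖X‖ := norm_pos_iff.2 (sub_ne_zero.2 hx0)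
  have hXc : 0 < ‖X‖ / c := by positivity
  have hα : ‖α‖ ≤ δ := by linarith
  have hfar : ∀ β, ‖β‖ ≤ δ₀ → 3 / 4 * ‖X‖ ≤ ‖x - φ β‖ := fun β hβ =>
    h.le_norm_sub_map (hα.trans hδ) hβ (by
      refine hAx.trans ?_
      rw [div_eq_mul_inv, mul_comm]
      gcongr
      linarith)
  have hreg : ∀ y ∈ K, ‖y - x‖ < ‖X‖ / 2 → IsRegularPoint k K y := by
    intro y hy hyx
    refine h.regular y hy ?_ ?_
    · have := norm_sub_le_norm_sub_add_norm_sub y x (φ 0)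
      linarith
    · rintro ⟨β, hβ, rfl⟩
      have := hfar β (by simpa using hβ)
      rw [norm_sub_rev] at hyx
      linarith
  obtain ⟨S, -, hS⟩ := hreg x hx (by simpa using hXpos)
  set β := (c ^ 2)⁻¹ • A X with hβ
  have hβn : ‖β‖ ≤ ‖X‖ / c := by
    rw [hβ, norm_smul, Real.norm_of_nonneg (by positivity)]
    calc _ ≤ (c ^ 2)⁻¹ * (c * ‖X‖) := by gcongr
      _ = _ := by field_simp
  have hαβ : ‖α + β‖ ≤ δ := (norm_add_le _ _).trans (by linarith)
  have hsub : HasFDerivAt (fun z : Euc n => z - φ α) (ContinuousLinearMap.id ℝ (Euc n)) x :=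
    (hasFDerivAt_id x).sub_const _
  have hd := hsub.norm_sq.sub ((A.hasFDerivAt.comp x hsub).norm_sq.const_mul (c ^ 2)⁻¹)
  have hG : X - J β ∈ Sᗮ := by
    rw [Submodule.mem_orthogonal]
    intro b hb
    have h0 := hS.fderiv_eq_zero hd hloc hb
    simp only [sub_apply, ContinuousLinearMap.comp_apply, smul_apply, Function.comp_apply,
      ContinuousLinearMap.id_apply, innerSL_apply_apply, smul_eq_mul, nsmul_eq_mul,
      Nat.cast_ofNat] at h0
    rw [← hX, real_inner_comm, ← h.inner_left] at h0
    rw [inner_sub_right, hβ, map_smul, inner_smul_right]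
    have h1 : ⟪J (A X), b⟫ = ⟪b, J (A X)⟫ := real_inner_comm _ _
    rw [h1] at h0
    linarith [real_inner_comm b X]
  set err := φ (α + β) - φ α - J β with herr
  have herrn : ‖err‖ ≤ ‖X‖ / 100 := by
    have := h.norm_sub_sub_le hδ hε hα hαβ
    rw [add_sub_cancel_left] at this
    calc _ ≤ c / 100 * ‖β‖ := this
      _ ≤ c / 100 * (‖X‖ / c) := by gcongr
      _ = _ := by field_simp
  have hsplit : φ (α + β) - x = err - (X - J β) := by
    rw [herr, hX]; abel
  have hproj : S.starProjection (φ (α + β) - x) = S.starProjection err := by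
    rw [hsplit, map_sub, (Submodule.starProjection_apply_eq_zero_iff _).2 hG, sub_zero]
  have hup : ‖φ (α + β) - x‖ ≤ r / 100 := by
    have h1 := h.norm_map_sub_le (hα.trans hδ) (hαβ.trans hδ)
    rw [add_sub_cancel_left] at h1
    have h2 := norm_sub_le_norm_sub_add_norm_sub (φ (α + β)) (φ α) x
    rw [norm_sub_rev (φ α), ← hX] at h2
    linarith
  have hlow := hinj.le_norm_starProjection hK hx hS (ρ := ‖X‖ / 2) (by positivity)
    (by linarith) hreg (h.map_mem (hαβ.trans hδ))
    (by rw [norm_sub_rev (φ _) x]; linarith [hfar _ (hαβ.trans hδ)]) hup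
  rw [hproj] at hlow
  have := S.norm_starProjection_apply_le err
  linarith

/-- If a point of the disc is accumulated by the rest of `K`, then at every small distance from
it there is a point of `K` in nearly normal direction. -/
lemma exists_normal_point (h : IsFlatDisc K φ J A φ' δ₀ R₀) (hinj : NormalInjective K r)
    (hr : 0 < r) (hK : IsCompact K) {c : ℝ} (hc0 : 0 < c) (hc : c ≤ 1 / 40) :
    ∃ δ > 0, ∀ α, ‖α‖ < δ → φ α ∈ closure (K \ φ '' Metric.closedBall 0 δ₀) →
      ∀ η, 0 < η → η < δ → ∃ y ∈ K, (1 - c) * η ≤ ‖y - φ α‖ ∧ ‖y - φ α‖ ≤ (1 + c) * η ∧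
        ‖A (y - φ α)‖ ≤ c * η := by
  set c₁ := c / 2 with hc₁
  have hc₁0 : 0 < c₁ := by positivity
  obtain ⟨δ₁, hδ₁, hsmall⟩ := h.norm_deriv_sub_small (c₁ / 100) (by positivity)
  set m := min (min δ₀ δ₁) (min R₀ (r / 100)) with hm
  have hm0 : 0 < m := by
    have := h.radius_pos
    have := h.regular_pos
    simp only [hm, lt_min_iff]
    exact ⟨⟨by positivity, by positivity⟩, by positivity, by positivity⟩
  have hmδ₀ : m ≤ δ₀ := (min_le_left _ _).trans (min_le_left _ _)
  have hmδ₁ : m ≤ δ₁ := (min_le_left _ _).trans (min_le_right _ _)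
  have hmR : m ≤ R₀ := (min_le_right _ _).trans (min_le_left _ _)
  have hmr : m ≤ r / 100 := (min_le_right _ _).trans (min_le_right _ _)
  set δ := m / (6 + 2 / c₁) with hδ
  have hδ0 : 0 < δ := by positivity
  have hδm : 6 * δ + 2 * (δ / c₁) = m := by
    rw [hδ]; field_simp
  have hδc : 0 < δ / c₁ := by positivity
  refine ⟨δ, hδ0, fun α hα hαcl η hη hηδ => ?_⟩
  have hαδ₀ : ‖α‖ ≤ δ₀ := by linarith
  set D := φ '' Metric.closedBall 0 δ₀ with hD
  set t := c * η / 8 with ht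
  have ht0 : 0 < t := by positivity
  have htη : t ≤ η / 320 := by rw [ht]; nlinarith
  obtain ⟨x₁, ⟨hx₁K, hx₁D⟩, hx₁⟩ := Metric.mem_closure_iff.1 hαcl t ht0
  rw [dist_comm, dist_eq_norm] at hx₁
  obtain ⟨_, ⟨α₁, hα₁, rfl⟩, hnear⟩ := exists_nearest h.isCompact_image
    ⟨φ α, α, by simpa using hαδ₀, rfl⟩ x₁
  rw [mem_closedBall_zero_iff] at hα₁
  have hd1 : ‖x₁ - φ α₁‖ < t := by
    have := hnear (φ α) ⟨α, by simpa using hαδ₀, rfl⟩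
    rw [norm_sub_rev, norm_sub_rev (φ α)] at this
    linarith
  have hd2 : ‖φ α₁ - φ α‖ < 2 * t := by
    have := norm_sub_le_norm_sub_add_norm_sub (φ α₁) x₁ (φ α)
    rw [norm_sub_rev (φ α₁) x₁] at this
    linarith
  have hα₁α : ‖α₁ - α‖ ≤ 3 * t := by
    have := h.le_norm_map_sub hαδ₀ hα₁
    linarith [norm_nonneg (α₁ - α)]
  have hα₁n : ‖α₁‖ ≤ 2 * δ := by
    have := norm_le_norm_sub_add α₁ α
    linarith
  have hx₁0 : 0 < ‖x₁ - φ α₁‖ := by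
    rw [norm_pos_iff, sub_ne_zero]
    rintro rfl
    exact hx₁D ⟨α₁, by simpa using hα₁, rfl⟩
  set f : Euc n → ℝ := fun z => ‖z - φ α₁‖ ^ 2 - (c₁ ^ 2)⁻¹ * ‖A (z - φ α₁)‖ ^ 2 with hf
  have hfx₁ : 0 < f x₁ := by
    have h1 := h.norm_adjoint_sub_le (α := α₁) (by linarith) (hsmall α₁ (by linarith)) hnear
    have h2 : (c₁ ^ 2)⁻¹ * ‖A (x₁ - φ α₁)‖ ^ 2 ≤
        (c₁ ^ 2)⁻¹ * (c₁ / 100 * ‖x₁ - φ α₁‖) ^ 2 := by gcongr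
    have h3 : (c₁ ^ 2)⁻¹ * (c₁ / 100 * ‖x₁ - φ α₁‖) ^ 2 = ‖x₁ - φ α₁‖ ^ 2 / 10000 := by
      field_simp; norm_num
    have h4 : 0 < ‖x₁ - φ α₁‖ ^ 2 := by positivity
    simp only [hf]
    linarith
  have hx₁b : x₁ ∈ K ∩ Metric.closedBall (φ α₁) η :=
    ⟨hx₁K, by rw [Metric.mem_closedBall, dist_eq_norm]; linarith⟩
  obtain ⟨y, ⟨hyK, hyb⟩, hy⟩ := (hK.inter_right (Metric.isClosed_closedBall
    (x := φ α₁) (ε := η))).exists_isMaxOn (f := f) ⟨x₁, hx₁b⟩ (by fun_prop)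
  rw [Metric.mem_closedBall, dist_eq_norm] at hyb
  have hfy : 0 < f y := hfx₁.trans_le (hy hx₁b)
  have hAy : ‖A (y - φ α₁)‖ ≤ c₁ * ‖y - φ α₁‖ := by
    refine (pow_le_pow_iff_left₀ (norm_nonneg _) (by positivity) two_ne_zero).1 ?_
    simp only [hf, sub_pos] at hfy
    rw [inv_mul_lt_iff₀ (by positivity)] at hfy
    rw [mul_pow]
    exact hfy.le
  have hy0 : y ≠ φ α₁ := by
    rintro rfl
    simp [hf] at hfy
  have hyη : ‖y - φ α₁‖ = η := by
    by_contra hne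
    have hlt : ‖y - φ α₁‖ < η := lt_of_le_of_ne hyb hne
    have hloc : IsLocalMaxOn f K y := by
      have h3 : ∀ᶠ z in 𝓝 y, z ∈ Metric.closedBall (φ α₁) η :=
        Filter.mem_of_superset (Metric.isOpen_ball.mem_nhds (by
          rw [Metric.mem_ball, dist_eq_norm]; exact hlt)) Metric.ball_subset_closedBall
      filter_upwards [eventually_mem_nhdsWithin, h3.filter_mono nhdsWithin_le_nhds] with z hz hz'
        using hy ⟨hz, hz'⟩
    have hyc : ‖y - φ α₁‖ / c₁ ≤ δ / c₁ := by gcongr; linarith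
    refine h.not_isLocalMaxOn hinj hK hc₁0 (by linarith) (min_le_left δ₀ δ₁)
      (fun β hβ => hsmall β (hβ.trans (min_le_right _ _))) hyK hy0 hAy ?_ ?_ ?_ hloc
    · rw [le_min_iff]; constructor <;> linarith
    · linarith
    · have h1 := norm_sub_le_norm_sub_add_norm_sub y (φ α₁) (φ 0)
      have h2 := h.norm_map_sub_le (α := 0) (β := α₁) (by simpa using h.radius_pos.le) hα₁
      rw [sub_zero] at h2
      linarith
  have hctr : y - φ α = (y - φ α₁) + (φ α₁ - φ α) := by abel
  refine ⟨y, hyK, ?_, ?_, ?_⟩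
  · have h1 := norm_sub_le_norm_sub_add_norm_sub y (φ α) (φ α₁)
    rw [norm_sub_rev (φ α), hyη] at h1
    linarith
  · have h1 := norm_sub_le_norm_sub_add_norm_sub y (φ α₁) (φ α)
    linarith
  · rw [hctr, map_add]
    refine (norm_add_le _ _).trans ?_
    have h1 := h.norm_adjoint_le (φ α₁ - φ α)
    rw [hyη] at hAy
    rw [hc₁] at hAy
    linarith

end IsFlatDisc

lemma exists_notMem_slabs {ι F : Type*} [NormedAddCommGroup F] [InnerProductSpace ℝ F] {θ : ℝ}
    (hθ : 0 ≤ θ) (s : Finset ι) (u : ι → F) (b : ι → ℝ) (hu : ∀ i ∈ s, ‖u i‖ = 1) :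
    ∀ (x₀ : F) (R : ℝ), θ * 4 ^ s.card < R →
      ∃ x, ‖x - x₀‖ ≤ R ∧ ∀ i ∈ s, θ < |⟪u i, x⟫ - b i| := by
  classical
  induction s using Finset.induction_on with
  | empty =>
    intro x₀ R hR
    refine ⟨x₀, ?_, by simp⟩
    simp at hR ⊢
    linarith
  | insert j s hj ih =>
    intro x₀ R hR
    rw [Finset.card_insert_of_notMem hj, pow_succ] at hR
    have h1 : θ * 1 ≤ θ * 4 ^ s.card := by
      gcongr
      exact one_le_pow₀ (by norm_num)
    have huj : ‖u j‖ = 1 := hu j (Finset.mem_insert_self _ _)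
    have huu : ⟪u j, u j⟫ = 1 := by rw [real_inner_self_eq_norm_sq, huj, one_pow]
    obtain ⟨σ, hσ, hσa⟩ : ∃ σ : ℝ, |σ| = 3 * R / 4 ∧
        3 * R / 4 ≤ |⟪u j, x₀⟫ - b j + σ| := by
      rcases le_total 0 (⟪u j, x₀⟫ - b j) with h | h
      · refine ⟨3 * R / 4, abs_of_nonneg (by linarith), ?_⟩
        rw [abs_of_nonneg (by linarith)]; linarith
      · refine ⟨-(3 * R / 4), by rw [abs_neg, abs_of_nonneg (by linarith)], ?_⟩
        rw [abs_of_nonpos (by linarith)]; linarith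
    obtain ⟨x, hx, hxs⟩ := ih (fun i hi => hu i (Finset.mem_insert_of_mem hi))
      (x₀ + σ • u j) (R / 4) (by linarith)
    refine ⟨x, ?_, ?_⟩
    · have h2 := norm_sub_le_norm_sub_add_norm_sub x (x₀ + σ • u j) x₀
      rw [add_sub_cancel_left, norm_smul, huj, Real.norm_eq_abs, hσ] at h2
      linarith
    · intro i hi
      rcases Finset.mem_insert.1 hi with rfl | hi
      · have h3 : ⟪u i, x⟫ - b i =
            (⟪u i, x₀⟫ - b i + σ) + ⟪u i, x - (x₀ + σ • u i)⟫ := by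
          rw [inner_sub_right, inner_add_right, inner_smul_right, huu]; ring
        have h4 : |⟪u i, x - (x₀ + σ • u i)⟫| ≤ R / 4 := by
          refine (abs_real_inner_le_norm _ _).trans ?_
          rw [huj, one_mul]
          exact hx
        rw [h3]
        have h5 := abs_sub_abs_le_abs_sub (⟪u i, x₀⟫ - b i + σ)
          (-⟪u i, x - (x₀ + σ • u i)⟫)
        rw [abs_neg, sub_neg_eq_add] at h5
        linarith
      · exact hxs i hi

namespace IsFlatDisc

variable {φ : Euc k → Euc n} {J : Euc k →L[ℝ] Euc n} {A : Euc n →L[ℝ] Euc k}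
  {φ' : Euc k → Euc k →L[ℝ] Euc n} {δ₀ R₀ : ℝ}

/-- If the centre of the disc is singular, then all points of the disc near the centre are
accumulated by the rest of `K`. -/
lemma exists_forall_mem_closure (h : IsFlatDisc K φ J A φ' δ₀ R₀) (hinj : NormalInjective K r)
    (hr : 0 < r) (hK : IsCompact K) (hsing : ¬ IsRegularPoint k K (φ 0)) :
    ∃ δ > 0, ∀ α, ‖α‖ < δ → φ α ∈ closure (K \ φ '' Metric.closedBall 0 δ₀) := by
  have hzero : ‖(0 : Euc k)‖ ≤ δ₀ := by simpa using h.radius_pos.le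
  have hcl0 : φ 0 ∈ closure (K \ φ '' Metric.closedBall 0 δ₀) := by
    by_contra hfree
    exact hsing (h.isRegularPoint (by simpa using h.radius_pos) hfree)
  obtain ⟨δ₁, hδ₁, hgrow⟩ := h.exists_normal_point hinj hr hK (c := 1 / 40) (by norm_num) le_rfl
  set m := min (min δ₀ δ₁) (min R₀ r) with hm
  have hm0 : 0 < m := by
    have := h.radius_pos
    have := h.regular_pos
    simp only [hm, lt_min_iff]
    exact ⟨⟨by positivity, by positivity⟩, by positivity, by positivity⟩
  have hmδ₀ : m ≤ δ₀ := (min_le_left _ _).trans (min_le_left _ _)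
  have hmδ₁ : m ≤ δ₁ := (min_le_left _ _).trans (min_le_right _ _)
  have hmR : m ≤ R₀ := (min_le_right _ _).trans (min_le_left _ _)
  have hmr : m ≤ r := (min_le_right _ _).trans (min_le_right _ _)
  refine ⟨m / 100, by positivity, fun α hα => ?_⟩
  by_contra hfree
  have hα0 : α ≠ 0 := by
    rintro rfl
    exact hfree hcl0
  have hαpos : 0 < ‖α‖ := norm_pos_iff.2 hα0
  have hαδ : ‖α‖ < δ₀ := by linarith
  set η := 40 * ‖α‖ with hη
  obtain ⟨y, hyK, hy1, hy2, hy3⟩ := hgrow 0 (by simpa using hδ₁) hcl0 η (by positivity)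
    (by linarith)
  have hd := h.norm_map_sub_le hzero hαδ.le
  rw [sub_zero] at hd
  have hT := h.hasTangentSpace hαδ hfree
  set T := (φ' α).range with hTdef
  set τ := T.starProjection (y - φ α) with hτ
  have hτn : ‖τ‖ ≤ η / 5 := by
    obtain ⟨v, hv⟩ : τ ∈ T := Submodule.starProjection_apply_mem _ _
    have hv : φ' α v = τ := hv
    have hsub : ‖(φ' α - J) v‖ ≤ 1 / 100 * ‖v‖ :=
      ((φ' α - J).le_opNorm v).trans (by gcongr; exact h.norm_deriv_sub_le α hαδ.le)
    have hvn : ‖v‖ ≤ ‖τ‖ + 1 / 100 * ‖v‖ := by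
      have h1 := norm_le_norm_sub_add (J v) (φ' α v)
      rw [h.norm_map, norm_sub_rev, ← sub_apply, hv] at h1
      linarith
    have h2 : ‖τ‖ ^ 2 = ⟪τ, y - φ α⟫ := by
      have h3 : ⟪y - φ α - τ, τ⟫ = 0 :=
        Submodule.starProjection_inner_eq_zero _ _ (Submodule.starProjection_apply_mem _ _)
      rw [inner_sub_left, real_inner_self_eq_norm_sq, real_inner_comm] at h3
      linarith
    have h4 : ⟪τ, y - φ α⟫ = ⟪v, A (y - φ 0)⟫ + ⟪(φ' α - J) v, y - φ 0⟫ -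
        ⟪τ, φ α - φ 0⟫ := by
      rw [← h.inner_left, ← inner_add_left, sub_apply, add_sub_cancel, hv, ← inner_sub_right]
      congr 1; abel
    have h5 : ⟪v, A (y - φ 0)⟫ ≤ ‖v‖ * (1 / 40 * η) :=
      (real_inner_le_norm _ _).trans (by gcongr)
    have h6 : ⟪(φ' α - J) v, y - φ 0⟫ ≤ (1 / 100 * ‖v‖) * ((1 + 1 / 40) * η) :=
      (real_inner_le_norm _ _).trans (by gcongr)
    have h7 : -⟪τ, φ α - φ 0⟫ ≤ ‖τ‖ * (101 / 100 * ‖α‖) := by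
      rw [← inner_neg_right]
      refine (real_inner_le_norm _ _).trans ?_
      rw [norm_neg]
      gcongr
    by_contra! hlt
    have hvτ : ‖v‖ ≤ 100 / 99 * ‖τ‖ := by linarith
    have hη0 : 0 < η := by positivity
    have h8 : ‖v‖ * η ≤ 100 / 99 * ‖τ‖ * η := by gcongr
    have h9 : ‖τ‖ * ‖α‖ = ‖τ‖ * η / 40 := by rw [hη]; ring
    nlinarith [mul_pos (hη0.trans_le (by linarith : η ≤ 5 * ‖τ‖)) hη0]
  set x := y - τ with hx
  have hxy : ‖y - x‖ ≤ η / 5 := by rw [hx]; simpa using hτn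
  obtain ⟨z, hzK, hz⟩ := exists_nearest hK ⟨y, hyK⟩ x
  have hzx : ‖z - x‖ ≤ η / 5 := (hz y hyK).trans hxy
  have hzy : ‖z - y‖ ≤ 2 * (η / 5) := by
    have := norm_sub_le_norm_sub_add_norm_sub z x y
    rw [norm_sub_rev x y] at this
    linarith
  have hzD : z ∉ φ '' Metric.closedBall 0 δ₀ := by
    rintro ⟨β, hβ, rfl⟩
    have := h.le_norm_sub_map hzero (y := y) (β := β) (by simpa using hβ) (by linarith)
    rw [norm_sub_rev y (φ β)] at this
    linarith
  have hzreg : IsRegularPoint k K z := by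
    refine h.regular z hzK ?_ hzD
    have := norm_sub_le_norm_sub_add_norm_sub z y (φ 0)
    linarith
  have hxα : x - φ α ∈ Tᗮ := by
    have : x - φ α = (y - φ α) - τ := by rw [hx]; abel
    rw [this]
    exact Submodule.sub_starProjection_mem_orthogonal _
  have hzα : z = φ α := by
    refine hinj z hzK (φ α) (h.map_mem hαδ.le) (x - z) (x - φ α) (isNormalAt_of_nearest hzreg hz)
      (hT.1 _ hxα) ?_ ?_ (by abel)
    · rw [norm_sub_rev]; linarith
    · have h1 := norm_sub_le_norm_sub_add_norm_sub x y (φ α)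
      have h2 := norm_sub_le_norm_sub_add_norm_sub y (φ 0) (φ α)
      rw [norm_sub_rev x y] at h1
      rw [norm_sub_rev (φ 0) (φ α)] at h2
      linarith
  exact hzD ⟨α, by simpa using hαδ.le, hzα.symm⟩

/-- At a point of `K` in nearly normal direction from the disc, some tangential direction of the
disc is nearly normal to `K`. -/
lemma exists_norm_starProjection_le (h : IsFlatDisc K φ J A φ' δ₀ R₀)
    (hinj : NormalInjective K r) (hK : IsCompact K) {θ δ ρ : ℝ} (hθ : 0 < θ)
    (hδ : δ ≤ δ₀) (hε : ∀ α, ‖α‖ ≤ δ → ‖φ' α - J‖ ≤ θ / 100) {α : Euc k} {y : Euc n}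
    (hy : y ∈ K) (hS : HasTangentSpace K y S) (hSk : finrank ℝ S ≤ k) (hρ : 0 < ρ)
    (hρr : ρ ≤ r / 4) (hreg : ∀ x ∈ K, ‖x - y‖ < ρ → IsRegularPoint k K x)
    (hfar : ∀ β, ‖β‖ ≤ δ₀ → ρ ≤ ‖y - φ β‖) (hyρ : ‖y - φ α‖ ≤ 5 * ρ)
    (hαδ : ‖α‖ + ‖y - φ α‖ / θ ≤ δ)
    (hr : 2 * (‖y - φ α‖ / θ) + ‖y - φ α‖ ≤ r / 100) :
    ∃ u, ‖u‖ = 1 ∧ ‖S.starProjection (J u)‖ ≤ θ := by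
  by_contra! hcon
  have hlow : ∀ v, θ * ‖v‖ ≤ ‖S.starProjection (J v)‖ := by
    intro v
    rcases eq_or_ne v 0 with rfl | hv
    · simp
    have h1 := hcon (‖v‖⁻¹ • v) (norm_smul_inv_norm hv)
    rw [map_smul, map_smul, norm_smul, norm_inv, norm_norm,
      lt_inv_mul_iff₀ (norm_pos_iff.2 hv)] at h1
    linarith
  set L : Euc k →ₗ[ℝ] S :=
    (S.orthogonalProjectionOnto : Euc n →ₗ[ℝ] S) ∘ₗ (J : Euc k →ₗ[ℝ] Euc n) with hL
  have hLinj : Function.Injective L := by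
    rw [← LinearMap.ker_eq_bot, LinearMap.ker_eq_bot']
    intro v hv
    have h1 : S.starProjection (J v) = 0 := by
      have : S.orthogonalProjectionOnto (J v) = 0 := hv
      rw [Submodule.starProjection_apply, this, Submodule.coe_zero]
    have h2 := hlow v
    rw [h1, norm_zero] at h2
    have : ‖v‖ ≤ 0 := by
      by_contra! h3
      have := mul_pos hθ h3
      linarith
    exact norm_le_zero_iff.1 this
  have hfin : finrank ℝ (Euc k) = finrank ℝ S := by
    refine le_antisymm (LinearMap.finrank_le_finrank_of_injective hLinj) ?_
    simpa using hSk
  have hLsurj := (LinearMap.injective_iff_surjective_of_finrank_eq_finrank hfin).1 hLinj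
  obtain ⟨v, hv⟩ := hLsurj (S.orthogonalProjectionOnto (y - φ α))
  have hv' : S.starProjection (J v) = S.starProjection (y - φ α) := by
    rw [Submodule.starProjection_apply, Submodule.starProjection_apply, ← hv]
    rfl
  have hvn : ‖v‖ ≤ ‖y - φ α‖ / θ := by
    rw [le_div_iff₀ hθ, mul_comm]
    refine (hlow v).trans ?_
    rw [hv']
    exact S.norm_starProjection_apply_le _
  have hαδ' : ‖α‖ ≤ δ := by
    have : 0 ≤ ‖y - φ α‖ / θ := by positivity
    linarith
  have hαv : ‖α + v‖ ≤ δ := (norm_add_le _ _).trans (by linarith)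
  have herr := h.norm_sub_sub_le hδ hε hαδ' hαv
  rw [add_sub_cancel_left] at herr
  have hproj : S.starProjection (φ (α + v) - y) =
      S.starProjection (φ (α + v) - φ α - J v) := by
    have : φ (α + v) - y = (φ (α + v) - φ α - J v) + (J v - (y - φ α)) := by abel
    rw [this, map_add, map_sub _ (J v), hv', sub_self, add_zero]
  have h1 := hinj.le_norm_starProjection hK hy hS hρ hρr hreg
    (h.map_mem (hαv.trans hδ)) (by rw [norm_sub_rev]; exact hfar _ (hαv.trans hδ)) (by
      have h2 := h.norm_map_sub_le (hαδ'.trans hδ) (hαv.trans hδ)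
      rw [add_sub_cancel_left] at h2
      have h3 := norm_sub_le_norm_sub_add_norm_sub (φ (α + v)) (φ α) y
      rw [norm_sub_rev (φ α) y] at h3
      linarith [norm_nonneg v])
  rw [hproj] at h1
  have h2 := S.norm_starProjection_apply_le (φ (α + v) - φ α - J v)
  have h3 : θ / 100 * ‖v‖ ≤ θ / 100 * (‖y - φ α‖ / θ) := by gcongr
  have h4 : θ / 100 * (‖y - φ α‖ / θ) = ‖y - φ α‖ / 100 := by field_simp
  linarith

/-- If a tangential direction `u` of the disc is nearly normal to `K` at a point `y`, and `z` is
a point near `y`, then the base points of `y` and `z` in the disc lie in a slab normal to `u`. -/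
lemma abs_inner_sub_le (h : IsFlatDisc K φ J A φ' δ₀ R₀) (hinj : NormalInjective K r)
    (hr : 0 < r) (hK : IsCompact K) {θ δ η : ℝ} (hθ : 0 < θ)
    (hδ : δ ≤ δ₀) (hε : ∀ α, ‖α‖ ≤ δ → ‖φ' α - J‖ ≤ θ / 100) {y z : Euc n} (hy : y ∈ K)
    (hz : z ∈ K) (hS : HasTangentSpace K y S) (hη : 0 < η) (hηr : η / 4 ≤ r / 4)
    (hηθ : η ≤ θ * r) (hreg : ∀ x ∈ K, ‖x - y‖ < η / 4 → IsRegularPoint k K x)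
    (hzy : ‖z - y‖ < η / 4) {α β : Euc k} (hα : ‖α‖ ≤ δ) (hβ : ‖β‖ ≤ δ)
    (hαβ : ‖β - α‖ ≤ 2 * η) (hAy : ‖A (y - φ α)‖ ≤ θ / 40 * η)
    (hAz : ‖A (z - φ β)‖ ≤ θ / 40 * η) {u : Euc k} (hu : ‖u‖ = 1)
    (huS : ‖S.starProjection (J u)‖ ≤ θ) : |⟪u, β - α⟫| ≤ η * θ := by
  set s := S.starProjection (J u) with hs
  have hw : J u - s ∈ Sᗮ := Submodule.sub_starProjection_mem_orthogonal _
  have hwn : ‖J u - s‖ ≤ 1 := by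
    have := Submodule.norm_starProjection_apply_le Sᗮ (J u)
    rwa [Submodule.starProjection_orthogonal_val, h.norm_map, hu] at this
  set Z := z - y with hZ
  have hquad : ‖J u - s‖ * ‖Z‖ ^ 2 / r ≤ η * θ / 16 := by
    rw [div_le_iff₀ hr]
    calc _ ≤ 1 * (η / 4) ^ 2 := by gcongr
      _ = η * η / 16 := by ring
      _ ≤ η * (θ * r) / 16 := by gcongr
      _ = _ := by ring
  have hflat1 := hinj.inner_le hK hy hS hηr hreg hz hzy hw
  have hflat2 := hinj.inner_le hK hy hS hηr hreg hz hzy (Sᗮ.neg_mem hw)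
  rw [inner_neg_left, norm_neg] at hflat2
  have hsZ : |⟪s, Z⟫| ≤ θ * (η / 4) :=
    (abs_real_inner_le_norm _ _).trans (by gcongr)
  set e := φ β - φ α - J (β - α) with he
  have heu : |⟪J u, e⟫| ≤ θ / 100 * (2 * η) := by
    refine (abs_real_inner_le_norm _ _).trans ?_
    rw [h.norm_map, hu, one_mul]
    exact (h.norm_sub_sub_le hδ hε hα hβ).trans (by gcongr)
  have hAu : ∀ x : Euc n, ‖A x‖ ≤ θ / 40 * η → |⟪J u, x⟫| ≤ θ / 40 * η := by
    intro x hx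
    rw [h.inner_left]
    refine (abs_real_inner_le_norm _ _).trans ?_
    rwa [hu, one_mul]
  have hsplit : Z = J (β - α) + e + (z - φ β) - (y - φ α) := by
    rw [hZ, he]; abel
  have hmain : ⟪J u - s, Z⟫ + ⟪s, Z⟫ = ⟪u, β - α⟫ + ⟪J u, e⟫ + ⟪J u, z - φ β⟫ -
      ⟪J u, y - φ α⟫ := by
    rw [← inner_add_left, sub_add_cancel]
    conv_lhs => rw [hsplit]
    rw [inner_sub_right, inner_add_right, inner_add_right, h.inner_left u (J _), h.left_inv]
  have hAa := abs_le.1 (hAu _ hAy)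
  have hAb := abs_le.1 (hAu _ hAz)
  have heu' := abs_le.1 heu
  have hsZ' := abs_le.1 hsZ
  have hθη : 0 < θ * η := by positivity
  rw [abs_le]
  constructor <;> linarith

/-- If the centre of the disc is singular, then there are points of `K` above all points of a
small disc such that points above distant points are far apart, unless the points below lie in
a common slab. -/
lemma exists_slabs (h : IsFlatDisc K φ J A φ' δ₀ R₀) (hinj : NormalInjective K r)
    (hr : 0 < r) (hK : IsCompact K) (hsing : ¬ IsRegularPoint k K (φ 0)) {θ : ℝ} (hθ : 0 < θ)
    (hθ1 : θ ≤ 1) :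
    ∃ (Y : Euc k → Euc n) (U : Euc k → Euc k), ∀ a, ‖a‖ ≤ 1 → ‖Y a‖ ≤ 4 ∧ ‖U a‖ = 1 ∧
      ∀ b, ‖b‖ ≤ 1 → ‖Y b - Y a‖ < 1 / 4 → |⟪U a, b - a⟫| ≤ θ := by
  have hzero : ‖(0 : Euc k)‖ ≤ δ₀ := by simpa using h.radius_pos.le
  obtain ⟨δ₁, hδ₁, hcl⟩ := h.exists_forall_mem_closure hinj hr hK hsing
  obtain ⟨δ₂, hδ₂, hgrow⟩ := h.exists_normal_point hinj hr hK (c := θ / 40) (by positivity)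
    (by linarith)
  obtain ⟨δ₃, hδ₃, hsmall⟩ := h.norm_deriv_sub_small (θ / 100) (by positivity)
  set m := min (min (min δ₀ δ₃) (min δ₁ δ₂)) (min R₀ r) with hm
  have hm0 : 0 < m := by
    have := h.radius_pos
    have := h.regular_pos
    simp only [hm, lt_min_iff]
    exact ⟨⟨⟨by positivity, by positivity⟩, by positivity, by positivity⟩,
      by positivity, by positivity⟩
  have hmδ₀₃ : m ≤ min δ₀ δ₃ := (min_le_left _ _).trans (min_le_left _ _)
  have hmδ₀ : m ≤ δ₀ := hmδ₀₃.trans (min_le_left _ _)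
  have hmδ₁ : m ≤ δ₁ := (min_le_left _ _).trans ((min_le_right _ _).trans (min_le_left _ _))
  have hmδ₂ : m ≤ δ₂ := (min_le_left _ _).trans ((min_le_right _ _).trans (min_le_right _ _))
  have hmR : m ≤ R₀ := (min_le_right _ _).trans (min_le_left _ _)
  have hmr : m ≤ r := (min_le_right _ _).trans (min_le_right _ _)
  set η := m * θ / 500 with hη
  have hη0 : 0 < η := by positivity
  have hηθ : η / θ = m / 500 := by rw [hη]; field_simp
  have hηm : η ≤ m / 500 := by
    rw [hη]; gcongr; nlinarith
  have hηa : ∀ a : Euc k, ‖a‖ ≤ 1 → ‖η • a‖ ≤ η := by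
    intro a ha
    rw [norm_smul, Real.norm_of_nonneg hη0.le]
    nlinarith
  have hex : ∀ a : Euc k, ‖a‖ ≤ 1 → ∃ y ∈ K, (1 - θ / 40) * η ≤ ‖y - φ (η • a)‖ ∧
      ‖y - φ (η • a)‖ ≤ (1 + θ / 40) * η ∧ ‖A (y - φ (η • a))‖ ≤ θ / 40 * η := by
    intro a ha
    have := hηa a ha
    exact hgrow (η • a) (by linarith) (hcl _ (by linarith)) η hη0 (by linarith)
  choose! y hyK hy1 hy2 hy3 using hex
  have hy1' : ∀ a, ‖a‖ ≤ 1 → 39 / 40 * η ≤ ‖y a - φ (η • a)‖ := fun a ha =>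
    le_trans (by gcongr; linarith) (hy1 a ha)
  have hy2' : ∀ a, ‖a‖ ≤ 1 → ‖y a - φ (η • a)‖ ≤ 41 / 40 * η := fun a ha =>
    (hy2 a ha).trans (by gcongr; linarith)
  have hy3' : ∀ a, ‖a‖ ≤ 1 → ‖A (y a - φ (η • a))‖ ≤ 1 / 40 * η := fun a ha =>
    (hy3 a ha).trans (by gcongr)
  have hyq : ∀ a, ‖a‖ ≤ 1 → ‖y a - φ 0‖ ≤ 3 * η := by
    intro a ha
    have h1 := hηa a ha
    have h2 := h.norm_map_sub_le hzero (β := η • a) (by linarith)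
    rw [sub_zero] at h2
    have h3 := norm_sub_le_norm_sub_add_norm_sub (y a) (φ (η • a)) (φ 0)
    have h4 := hy2' a ha
    linarith
  have hfar : ∀ a, ‖a‖ ≤ 1 → ∀ β, ‖β‖ ≤ δ₀ → η / 2 ≤ ‖y a - φ β‖ := by
    intro a ha β hβ
    have h1 := hηa a ha
    have h2 := hy1' a ha
    have h3 := hy3' a ha
    have := h.le_norm_sub_map (α := η • a) (y := y a) (by linarith) hβ (by linarith)
    linarith
  have hreg : ∀ a, ‖a‖ ≤ 1 → ∀ x ∈ K, ‖x - y a‖ < η / 4 → IsRegularPoint k K x := by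
    intro a ha x hx hxy
    refine h.regular x hx ?_ ?_
    · have h1 := norm_sub_le_norm_sub_add_norm_sub x (y a) (φ 0)
      have h2 := hyq a ha
      linarith
    · rintro ⟨β, hβ, rfl⟩
      have := hfar a ha β (by simpa using hβ)
      rw [norm_sub_rev] at hxy
      linarith
  have hex2 : ∀ a, ‖a‖ ≤ 1 → ∃ u, ‖u‖ = 1 ∧ ∀ b, ‖b‖ ≤ 1 → ‖y b - y a‖ < η / 4 →
      |⟪u, b - a⟫| ≤ θ := by
    intro a ha
    obtain ⟨S, hSk, hS⟩ := hreg a ha (y a) (hyK a ha) (by simpa using hη0)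
    have h1 := hηa a ha
    have h2 := hy2' a ha
    have h3 : ‖y a - φ (η • a)‖ / θ ≤ 41 / 40 * (η / θ) := by
      rw [← mul_div_assoc]; gcongr
    obtain ⟨u, hu, huS⟩ := h.exists_norm_starProjection_le hinj hK hθ (min_le_left δ₀ δ₃)
      (fun β hβ => hsmall β (hβ.trans (min_le_right _ _))) (hyK a ha) hS hSk (ρ := η / 4)
      (α := η • a) (by positivity) (by linarith) (hreg a ha)
      (fun β hβ => by linarith [hfar a ha β hβ]) (by linarith)
      (by refine le_trans ?_ hmδ₀₃; linarith) (by linarith)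
    refine ⟨u, hu, fun b hb hba => ?_⟩
    have hb1 := hηa b hb
    have hηr : η ≤ θ * r := by
      rw [hη]
      nlinarith [mul_le_mul_of_nonneg_right hmr hθ.le, mul_pos hm0 hθ]
    have h4 := h.abs_inner_sub_le hinj hr hK hθ (min_le_left δ₀ δ₃)
      (fun β hβ => hsmall β (hβ.trans (min_le_right _ _))) (hyK a ha) (hyK b hb) hS hη0
      (by linarith) hηr (hreg a ha) hba (α := η • a) (β := η • b) (by linarith) (by linarith)
      ((_root_.norm_sub_le _ _).trans (by linarith)) (hy3 a ha) (hy3 b hb) hu huS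
    rw [← smul_sub, inner_smul_right, abs_mul, abs_of_pos hη0] at h4
    exact le_of_mul_le_mul_left h4 hη0
  choose! u hu hslab using hex2
  refine ⟨fun a => η⁻¹ • (y a - φ 0), u, fun a ha => ⟨?_, hu a ha, fun b hb hba => ?_⟩⟩
  · rw [norm_smul, norm_inv, Real.norm_of_nonneg hη0.le, inv_mul_le_iff₀ hη0]
    linarith [hyq a ha]
  · refine hslab a ha b hb ?_
    rw [← smul_sub, sub_sub_sub_cancel_right, norm_smul, norm_inv, Real.norm_of_nonneg hη0.le,
      inv_mul_lt_iff₀ hη0] at hba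
    linarith

/-- The centre of a flat disc is a regular point. -/
lemma isRegularPoint_center (h : IsFlatDisc K φ J A φ' δ₀ R₀) (hinj : NormalInjective K r)
    (hr : 0 < r) (hK : IsCompact K) : IsRegularPoint k K (φ 0) := by
  classical
  by_contra hsing
  obtain ⟨t, -, htfin, htcov⟩ := (isCompact_closedBall (0 : Euc n) 4).finite_cover_balls
    (e := 1 / 8) (by norm_num)
  lift t to Finset (Euc n) using htfin
  set θ : ℝ := (2 * 4 ^ t.card)⁻¹ with hθ
  have hone : (1 : ℝ) ≤ 4 ^ t.card := one_le_pow₀ (by norm_num)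
  have hθ0 : 0 < θ := by positivity
  have hθ1 : θ ≤ 1 := inv_le_one_of_one_le₀ (by linarith)
  obtain ⟨Y, U, hYU⟩ := h.exists_slabs hinj hr hK hsing hθ0 hθ1
  have hrep : ∀ i : Euc n, ∃ a : Euc k, ‖a‖ ≤ 1 ∧
      ((∃ b, ‖b‖ ≤ 1 ∧ Y b ∈ Metric.ball i (1 / 8)) → Y a ∈ Metric.ball i (1 / 8)) := by
    intro i
    by_cases hi : ∃ b, ‖b‖ ≤ 1 ∧ Y b ∈ Metric.ball i (1 / 8)
    · obtain ⟨b, hb, hb'⟩ := hi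
      exact ⟨b, hb, fun _ => hb'⟩
    · exact ⟨0, by simp, fun h' => absurd h' hi⟩
  choose a ha ha' using hrep
  obtain ⟨x, hx, hxs⟩ := exists_notMem_slabs hθ0.le t (fun i => U (a i))
    (fun i => ⟪U (a i), a i⟫) (fun i _ => (hYU (a i) (ha i)).2.1) 0 1 (by
      rw [hθ, inv_mul_lt_iff₀ (by positivity)]; linarith)
  rw [sub_zero] at hx
  have hYx : Y x ∈ Metric.closedBall (0 : Euc n) 4 := by simpa using (hYU x hx).1
  obtain ⟨i, hi, hYi⟩ := mem_iUnion₂.1 (htcov hYx)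
  have hai := ha' i ⟨x, hx, hYi⟩
  refine (hxs i hi).not_ge ?_
  rw [← inner_sub_right]
  refine (hYU (a i) (ha i)).2.2 x hx ?_
  rw [← dist_eq_norm]
  have := dist_triangle_right (Y x) (Y (a i)) i
  rw [Metric.mem_ball] at hai hYi
  linarith

end IsFlatDisc

lemma exists_comp_eq_isometry (L : Euc k →L[ℝ] Euc n) (hL : Function.Injective L) :
    ∃ (J : Euc k →ₗᵢ[ℝ] Euc n) (B : Euc k ≃L[ℝ] Euc k),
      L.comp (B : Euc k →L[ℝ] Euc k) = J.toContinuousLinearMap := by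
  let l : Euc k →ₗ[ℝ] Euc n := L
  have hl : Function.Injective l := hL
  have hfin : finrank ℝ (LinearMap.range l) = k := by
    rw [LinearMap.finrank_range_of_inj hl, finrank_euclideanSpace_fin]
  let e := ((stdOrthonormalBasis ℝ (LinearMap.range l)).reindex (finCongr hfin)).repr
  refine ⟨(LinearMap.range l).subtypeₗᵢ.comp e.symm.toLinearIsometry,
    (e.symm.toLinearEquiv.trans (LinearEquiv.ofInjective l hl).symm).toContinuousLinearEquiv, ?_⟩
  ext1 x
  exact congrArg Subtype.val ((LinearEquiv.ofInjective l hl).apply_symm_apply (e.symm x))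

/-- Around a point of a chart, a point set whose irregular points all lie in the image of a
compact set of parameters contains a flat disc. -/
lemma exists_isFlatDisc {U C : Set (Euc k)} {φ : Euc k → Euc n} (hU : IsOpen U)
    (hφ : ContDiffOn ℝ 1 φ U) (hinj : InjOn φ U) (hUK : φ '' U ⊆ K) {a : Euc k} (ha : a ∈ U)
    (hder : Function.Injective (fderiv ℝ φ a)) (hC : IsCompact C) (hCU : C ⊆ U)
    (hreg : ∀ᶠ x in 𝓝 (φ a), x ∈ K → x ∉ φ '' C → IsRegularPoint k K x) :
    ∃ (ψ : Euc k → Euc n) (J : Euc k →L[ℝ] Euc n) (A : Euc n →L[ℝ] Euc k)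
      (ψ' : Euc k → Euc k →L[ℝ] Euc n) (δ₀ R₀ : ℝ),
      IsFlatDisc K ψ J A ψ' δ₀ R₀ ∧ ψ 0 = φ a := by
  obtain ⟨J, B, hJ⟩ := exists_comp_eq_isometry _ hder
  have hg : Continuous fun α => a + B α := by fun_prop
  have hg0 : Tendsto (fun α => a + B α) (𝓝 0) (𝓝 a) := by
    simpa using hg.tendsto 0
  have hcont : Tendsto (fun α => ‖(fderiv ℝ φ (a + B α)).comp (B : Euc k →L[ℝ] Euc k)
      - J.toContinuousLinearMap‖) (𝓝 0) (𝓝 0) := by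
    have h1 : Tendsto (fderiv ℝ φ) (𝓝 a) (𝓝 (fderiv ℝ φ a)) :=
      (hφ.continuousOn_fderiv_of_isOpen hU le_rfl).continuousAt (hU.mem_nhds ha)
    have h2 : Continuous fun T : Euc k →L[ℝ] Euc n =>
        ‖T.comp (B : Euc k →L[ℝ] Euc k) - J.toContinuousLinearMap‖ := by fun_prop
    have := (h2.tendsto _).comp (h1.comp hg0)
    rwa [hJ, sub_self, norm_zero] at this
  have hsmall : ∀ ε > 0, ∃ δ > 0, ∀ α : Euc k, ‖α‖ ≤ δ → a + B α ∈ U ∧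
      ‖(fderiv ℝ φ (a + B α)).comp (B : Euc k →L[ℝ] Euc k) - J.toContinuousLinearMap‖ ≤ ε := by
    intro ε hε
    obtain ⟨δ, hδ, h⟩ := Metric.nhds_basis_closedBall.eventually_iff.1
      ((hg0.eventually (hU.mem_nhds ha)).and (hcont.eventually_le_const hε))
    exact ⟨δ, hδ, fun α hα => h (by simpa using hα)⟩
  obtain ⟨δ₀, hδ₀, h₀⟩ := hsmall (1 / 100) (by norm_num)
  have hM : IsCompact (C ∩ {c | δ₀ ≤ ‖B.symm (c - a)‖}) :=
    hC.inter_right (isClosed_le (by fun_prop) (by fun_prop))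
  have hMφ : IsClosed (φ '' (C ∩ {c | δ₀ ≤ ‖B.symm (c - a)‖})) :=
    (hM.image_of_continuousOn
      (hφ.continuousOn.mono (inter_subset_left.trans hCU))).isClosed
  have haM : φ a ∉ φ '' (C ∩ {c | δ₀ ≤ ‖B.symm (c - a)‖}) := by
    rintro ⟨c, ⟨hc, hca⟩, hφc⟩
    rw [hinj (hCU hc) ha hφc] at hca
    simp at hca
    linarith
  obtain ⟨R₀, hR₀, hR⟩ := Metric.nhds_basis_ball.eventually_iff.1
    ((hMφ.isOpen_compl.eventually_mem haM).and hreg)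
  refine ⟨fun α => φ (a + B α), J.toContinuousLinearMap,
    J.toContinuousLinearMap.adjoint, fun α => (fderiv ℝ φ (a + B α)).comp (B : Euc k →L[ℝ] Euc k),
    δ₀, R₀, ?_, by simp⟩
  constructor
  · intro v x
    rw [ContinuousLinearMap.adjoint_inner_right]
  · intro v
    refine ext_inner_left ℝ fun u => ?_
    rw [ContinuousLinearMap.adjoint_inner_right]
    exact J.inner_map_map u v
  · exact hδ₀
  · exact hR₀
  · rintro _ ⟨α, hα, rfl⟩
    exact hUK ⟨_, (h₀ α (by simpa using hα)).1, rfl⟩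
  · intro α hα
    have hd := ((hφ.differentiableOn one_ne_zero).differentiableAt
      (hU.mem_nhds (h₀ α hα).1)).hasFDerivAt
    exact hd.comp α (B.hasFDerivAt.const_add a)
  · exact fun α hα => (h₀ α hα).2
  · intro ε hε
    obtain ⟨δ, hδ, h⟩ := hsmall ε hε
    exact ⟨δ, hδ, fun α hα => (h α hα).2⟩
  · intro x hx hxR hxD
    have hxb : x ∈ Metric.ball (φ a) R₀ := by
      rw [Metric.mem_ball, dist_eq_norm]; simpa using hxR
    obtain ⟨h1, h2⟩ := hR hxb
    refine h2 hx fun ⟨c, hc, hcx⟩ => ?_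
    by_cases hcδ : δ₀ ≤ ‖B.symm (c - a)‖
    · exact h1 ⟨c, ⟨hc, hcδ⟩, hcx⟩
    · exact hxD ⟨B.symm (c - a), by simpa using (not_le.1 hcδ).le, by simpa using hcx⟩

/-- A compact subset of a chart domain has a relatively open nonempty part which is contained in
the image of a compact set of parameters. -/
lemma exists_isCompact_image_inter {U : Set (Euc k)} {φ : Euc k → Euc n} (hU : IsOpen U)
    (hφ : ContinuousOn φ U) {X : Set (Euc n)} (hX : IsCompact X) (hXne : X.Nonempty)
    (hXU : X ⊆ φ '' U) :
    ∃ C ⊆ U, IsCompact C ∧ ∃ O, IsOpen O ∧ (X ∩ O).Nonempty ∧ X ∩ O ⊆ φ '' C := by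
  have hσ : IsSigmaCompact U := by
    have := hU.locallyCompactSpace
    exact isSigmaCompact_iff_sigmaCompactSpace.2 inferInstance
  obtain ⟨C, hC, hCU⟩ := hσ
  have hsub : ∀ i, C i ⊆ U := fun i => hCU ▸ subset_iUnion C i
  have : CompactSpace X := isCompact_iff_compactSpace.1 hX
  have : Nonempty X := hXne.to_subtype
  obtain ⟨i, y, hy⟩ := nonempty_interior_of_iUnion_of_closed
    (f := fun i => ((↑) : X → Euc n) ⁻¹' (φ '' C i))
    (fun i => ((hC i).image_of_continuousOn (hφ.mono (hsub i))).isClosed.preimage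
      continuous_subtype_val) (by
        refine eq_univ_of_forall fun x => ?_
        obtain ⟨u, hu, hux⟩ := hXU x.2
        rw [← hCU] at hu
        obtain ⟨i, hi⟩ := mem_iUnion.1 hu
        exact mem_iUnion.2 ⟨i, u, hi, hux⟩)
  obtain ⟨O, hO, hOi⟩ := isOpen_induced_iff.1 (isOpen_interior
    (s := ((↑) : X → Euc n) ⁻¹' (φ '' C i)))
  refine ⟨C i, hsub i, hC i, O, hO, ⟨y, y.2, ?_⟩, fun x hx => ?_⟩
  · rw [← hOi] at hy; exact hy
  · have : (⟨x, hx.1⟩ : X) ∈ ((↑) : X → Euc n) ⁻¹' O := hx.2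
    rw [hOi] at this
    exact (interior_subset this : _ ∈ ((↑) : X → Euc n) ⁻¹' (φ '' C i))

lemma NormalInjective.isRegularPoint (hinj : NormalInjective K r) (hr : 0 < r)
    (hK : IsC1Submanifold k K) (hcomp : IsCompact K) (hp : p ∈ K) : IsRegularPoint k K p := by
  by_contra hbad
  obtain ⟨U, V, φ, hU, hV, hpV, hφ, hφi, hUV, hder⟩ := hK p hp
  obtain ⟨s, hs, hsV⟩ := Metric.nhds_basis_closedBall.mem_iff.1 (hV.mem_nhds hpV)
  set E := {x | x ∈ K ∧ ¬ IsRegularPoint k K x} ∩ Metric.ball p s with hE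
  have hXb : closure E ⊆ Metric.closedBall p s :=
    closure_minimal (inter_subset_right.trans Metric.ball_subset_closedBall)
      Metric.isClosed_closedBall
  have hXK : closure E ⊆ K :=
    closure_minimal (fun x hx => hx.1.1) hcomp.isClosed
  obtain ⟨C, hCU, hC, O, hO, ⟨y, hyX, hyO⟩, hXO⟩ := exists_isCompact_image_inter hU
    hφ.continuousOn (X := closure E) (hcomp.of_isClosed_subset isClosed_closure hXK)
    ⟨p, subset_closure ⟨⟨hp, hbad⟩, Metric.mem_ball_self hs⟩⟩
    (fun x hx => hUV ▸ ⟨hXK hx, hsV (hXb hx)⟩)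
  obtain ⟨q, hqO, hqE⟩ := mem_closure_iff.1 hyX O hO hyO
  obtain ⟨a, haC, rfl⟩ := hXO ⟨subset_closure hqE, hqO⟩
  obtain ⟨ψ, J, A, ψ', δ₀, R₀, hD, hψ⟩ := exists_isFlatDisc hU hφ hφi
    (hUV.subset.trans inter_subset_left) (hCU haC) (hder a (hCU haC)) hC hCU (by
      filter_upwards [hO.mem_nhds hqO, Metric.isOpen_ball.mem_nhds hqE.2] with x hxO hxb hxK hxC
      by_contra hx
      exact hxC (hXO ⟨subset_closure ⟨⟨hxK, hx⟩, hxb⟩, hxO⟩))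
  exact hqE.1.2 (hψ ▸ hD.isRegularPoint_center hinj hr hcomp)

/-- The normal exponential map is injective on normal vectors of length `< r` exactly when no
tangent ball of radius `< r` meets `K`. -/
lemma injOn_normal_iff (hK : IsC1Submanifold k K) (hcomp : IsCompact K) (hr : 0 < r) :
    InjOn (fun pv : Euc n × Euc n => pv.1 + pv.2)
      {pv | pv.1 ∈ K ∧ IsNormalAt K pv.1 pv.2 ∧ ‖pv.2‖ < r} ↔
    ∀ s ∈ {s : ℝ | 0 < s ∧ ∃ p ∈ K, ∃ w : Euc n, IsNormalAt K p w ∧ ‖w‖ = 1 ∧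
      ∃ q ∈ K, dist (p + s • w) q < s}, r ≤ s := by
  constructor
  · rintro h s ⟨hs, p, hp, w, hw, hw1, q, hq, hd⟩
    by_contra! hsr
    have hinj : NormalInjective K r := by
      intro p hp q hq v w hv hw hv' hw' heq
      have := @h (p, v) ⟨hp, hv, hv'⟩ (q, w) ⟨hq, hw, hw'⟩ heq
      exact congrArg Prod.fst this
    obtain ⟨z, hz, hmin⟩ := exists_nearest hcomp ⟨q, hq⟩ (p + s • w)
    have hn := isNormalAt_of_nearest (hinj.isRegularPoint hr hK hcomp hz) hmin
    have hzs : ‖p + s • w - z‖ < s := by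
      rw [norm_sub_rev]
      refine (hmin q hq).trans_lt ?_
      rwa [norm_sub_rev, ← dist_eq_norm]
    have hsw : ‖s • w‖ = s := by rw [norm_smul, hw1, mul_one, Real.norm_of_nonneg hs.le]
    have heq : p + s • w = z + (p + s • w - z) := by abel
    have := congrArg Prod.snd (@h (p, s • w) ⟨hp, hw.smul s, hsw.trans_lt hsr⟩
      (z, p + s • w - z) ⟨hz, hn, hzs.trans hsr⟩ heq)
    simp only at this
    rw [← this, hsw] at hzs
    exact lt_irrefl _ hzs
  · intro h
    have hdist : ∀ p ∈ K, ∀ q ∈ K, ∀ v, IsNormalAt K p v → 0 < ‖v‖ → ∀ s, 0 < s → s < r →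
        s ≤ ‖p + (s * ‖v‖⁻¹) • v - q‖ := by
      intro p hp q hq v hv hv0 s hs hsr
      by_contra! hlt
      refine hsr.not_ge (h s ⟨hs, p, hp, ‖v‖⁻¹ • v, hv.smul _,
        norm_smul_inv_norm (norm_pos_iff.1 hv0), q, hq, ?_⟩)
      rwa [dist_eq_norm, smul_smul]
    have hle : ∀ p ∈ K, ∀ q ∈ K, ∀ v u, IsNormalAt K p v → ‖v‖ < r → p + v = q + u →
        ‖v‖ ≤ ‖u‖ := by
      intro p hp q hq v u hv hvr heq
      rcases (norm_nonneg v).eq_or_lt with h0 | h0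
      · rw [← h0]; exact norm_nonneg u
      · have := hdist p hp q hq v hv h0 ‖v‖ h0 hvr
        rwa [mul_inv_cancel₀ h0.ne', one_smul, heq, add_sub_cancel_left] at this
    rintro ⟨p, v⟩ ⟨hp, hv, hvr⟩ ⟨q, u⟩ ⟨hq, hu, hur⟩ heq
    simp only at hp hv hvr hq hu hur heq
    have hnorm : ‖v‖ = ‖u‖ := le_antisymm (hle p hp q hq v u hv hvr heq)
      (hle q hq p hp u v hu hur heq.symm)
    have huv : v = u := by
      rcases (norm_nonneg v).eq_or_lt with h0 | h0
      · rw [norm_eq_zero.1 h0.symm, norm_eq_zero.1 (hnorm.symm.trans h0.symm)]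
      obtain ⟨s, h1, h2⟩ := exists_between hvr
      have hs : 0 < s := h0.trans h1
      have hd := hdist p hp q hq v hv h0 s hs h2
      set c := s * ‖v‖⁻¹ - 1 with hc
      have hc0 : 0 < c := by
        rw [hc, sub_pos, ← div_eq_mul_inv, one_lt_div h0]; exact h1
      have hcs : (c + 1) * ‖v‖ = s := by
        rw [hc]; field_simp; ring
      have he : p + (s * ‖v‖⁻¹) • v - q = u + c • v := by
        rw [show s * ‖v‖⁻¹ = 1 + c by rw [hc]; ring, add_smul, one_smul, ← add_assoc, heq]
        abel
      rw [he] at hd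
      have hsq : s ^ 2 ≤ ‖u + c • v‖ ^ 2 := by gcongr
      rw [norm_add_sq_real, norm_smul, inner_smul_right, Real.norm_of_nonneg hc0.le,
        ← hnorm, ← hcs] at hsq
      have hin : ‖v‖ * ‖v‖ ≤ ⟪u, v⟫ := by nlinarith
      have hz : ‖v - u‖ ^ 2 ≤ 0 := by
        rw [norm_sub_sq_real, ← hnorm, real_inner_comm]
        nlinarith
      exact sub_eq_zero.1 (norm_eq_zero.1 (pow_eq_zero_iff two_ne_zero |>.1
        (le_antisymm hz (sq_nonneg _))))
    subst huv
    exact Prod.ext (add_right_cancel heq) rfl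

lemma sSup_pos_lowerBounds_eq_sInf {B : Set ℝ} (hB : ∀ s ∈ B, 0 < s) :
    sSup ({0} ∪ {r | 0 < r ∧ ∀ s ∈ B, r ≤ s}) = sInf B := by
  rcases B.eq_empty_or_nonempty with rfl | hne
  · rw [Real.sInf_empty]
    refine Real.sSup_of_not_bddAbove fun ⟨M, hM⟩ => ?_
    have := hM (Or.inr ⟨by positivity, by simp⟩ : |M| + 1 ∈ _)
    linarith [le_abs_self M]
  · have hbdd : BddBelow B := ⟨0, fun s hs => (hB s hs).le⟩
    refine IsLUB.csSup_eq ⟨?_, ?_⟩ ⟨0, Or.inl rfl⟩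
    · rintro x (rfl | ⟨-, hx⟩)
      · exact le_csInf hne fun s hs => (hB s hs).le
      · exact le_csInf hne hx
    · intro M hM
      rcases (Real.sInf_nonneg fun s hs => (hB s hs).le).eq_or_lt with h0 | h0
      · rw [← h0]; exact hM (Or.inl rfl)
      · exact hM (Or.inr ⟨h0, fun s hs => csInf_le hbdd hs⟩)

end

/-- **Proposition 1 (Euclidean case): the normal injectivity radius equals the
rolling-ball radius.** For a compact `C¹` submanifold `K` of `ℝⁿ` without boundary,
`i(K, ℝⁿ) = R_O(K, ℝⁿ)`. -/
theorem normalInjRad_eq_ballRad {n k : ℕ} (K : Set (EuclideanSpace ℝ (Fin n)))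
    (hK : IsC1Submanifold k K) (hcomp : IsCompact K) (hne : K.Nonempty) :
    normalInjRad K = ballRad K := by
  have hset : {r : ℝ | 0 < r ∧
      Set.InjOn (fun pv : EuclideanSpace ℝ (Fin n) × EuclideanSpace ℝ (Fin n) => pv.1 + pv.2)
        {pv | pv.1 ∈ K ∧ IsNormalAt K pv.1 pv.2 ∧ ‖pv.2‖ < r}} =
      {r | 0 < r ∧ ∀ s ∈ {r : ℝ | 0 < r ∧ ∃ p ∈ K, ∃ w : EuclideanSpace ℝ (Fin n),
        IsNormalAt K p w ∧ ‖w‖ = 1 ∧ ∃ q ∈ K, dist (p + r • w) q < r}, r ≤ s} :=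
    Set.ext fun r => and_congr_right fun hr => injOn_normal_iff hK hcomp hr
  rw [normalInjRad, ballRad, hset]
  exact sSup_pos_lowerBounds_eq_sInf fun s hs => hs.1
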